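/- Let 0 < ρ ≤ 1 and let σ : 𝒟_{d⃗} → 𝒟_{d⃗} be an injective map with σ(R) ⊆ R and |σ(R)| = ρ|R| for every dyadic rectangle R. Define the scale shift of a : 𝒟_{d⃗} → ℂ by (Sa)(R') = ρ^{1/2}·a(σ^{-1}(R')) if R' is in the range of σ, and (Sa)(R') = 0 otherwise. Then for every κ > 0 there is a constant C_κ, depending only on κ and d⃗, such that ‖Sa‖_{CM} ≤ C_κ·ρ^{−κ}·‖a‖_{CM} for every a. (Coefficient form of: the scale shift operator Sh_{scale,ρ} maps product BMO(ℝ^{d⃗}) to itself with norm ≲ ρ^{−κ}.) -/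

import Mathlib

open MeasureTheory
open scoped ENNReal

noncomputable section

/-- The model for the product space `ℝ^{d⃗}`. -/
abbrev Rd (t : ℕ) (d : Fin t → ℕ) := EuclideanSpace ℝ ((s : Fin t) × Fin (d s))

/-- A dyadic rectangle `R = Q₁ × ⋯ × Q_t ⊆ ℝ^{d⃗}`, recorded by the scale `k s` and the
position `pos s` of the dyadic cube `Q_s = 2^{k s}(pos s + [0,1)^{d_s})`. -/
structure DyadicRect (t : ℕ) (d : Fin t → ℕ) where
  k : Fin t → ℤ
  pos : (s : Fin t) → Fin (d s) → ℤ

variable {t : ℕ} {d : Fin t → ℕ}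

/-- The subset of `ℝ^{d⃗}` corresponding to a dyadic rectangle. -/
def DyadicRect.toSet (R : DyadicRect t d) : Set (Rd t d) :=
  {x | ∀ (s : Fin t) (j : Fin (d s)),
    x ⟨s, j⟩ ∈ Set.Ico ((2 : ℝ) ^ (R.k s) * (R.pos s j))
      ((2 : ℝ) ^ (R.k s) * (R.pos s j + 1))}

/-- The product Carleson norm of a coefficient function `a : 𝒟_{d⃗} → ℂ`:
`sup_U (|U|⁻¹ Σ_{R ⊆ U} |a(R)|²)^{1/2}` over open sets `U` of finite positive measure. -/
def carlesonNorm (a : DyadicRect t d → ℂ) : ℝ≥0∞ :=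
  ⨆ (U : Set (Rd t d)) (_ : IsOpen U ∧ 0 < volume U ∧ volume U < ⊤),
    ((volume U)⁻¹ *
      ∑' R : {R : DyadicRect t d // R.toSet ⊆ U}, ((‖a R.1‖₊ : ℝ≥0∞)) ^ 2) ^ (1/2 : ℝ)

section DyadicMaximal

/-- The dyadic interval `2^k (n + [0,1))`. -/
def dyadicIco (k n : ℤ) : Set ℝ := Set.Ico ((2 : ℝ) ^ k * n) ((2 : ℝ) ^ k * (n + 1))

/-- The index of the dyadic interval of length `2^k` containing `u`. -/
def dyadicIndex (k : ℤ) (u : ℝ) : ℤ := ⌊u / (2 : ℝ) ^ k⌋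

lemma mem_dyadicIco {k n : ℤ} {u : ℝ} : u ∈ dyadicIco k n ↔ dyadicIndex k u = n := by
  have h : (0 : ℝ) < 2 ^ k := by positivity
  rw [dyadicIco, dyadicIndex, Int.floor_eq_iff, Set.mem_Ico, le_div_iff₀ h, div_lt_iff₀ h,
    mul_comm, mul_comm ((n : ℝ) + 1)]

lemma measurableSet_dyadicIco (k n : ℤ) : MeasurableSet (dyadicIco k n) := measurableSet_Ico

lemma measurable_dyadicIndex (k : ℤ) : Measurable (dyadicIndex k) :=
  Int.measurable_floor.comp (measurable_id.div_const _)

lemma volume_dyadicIco (k n : ℤ) : volume (dyadicIco k n) = ENNReal.ofReal ((2 : ℝ) ^ k) := by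
  rw [dyadicIco, Real.volume_Ico]
  congr 1
  ring

lemma iUnion_dyadicIco (k : ℤ) : ⋃ n, dyadicIco k n = Set.univ := by
  ext u
  simp [mem_dyadicIco]

lemma pairwise_disjoint_dyadicIco (k : ℤ) :
    Pairwise (Function.onFun Disjoint (dyadicIco k)) := by
  intro m n hmn
  refine Set.disjoint_left.2 fun u hm hn => hmn ?_
  rw [mem_dyadicIco] at hm hn
  exact hm.symm.trans hn

/-- Dyadic intervals are nested. -/
lemma dyadicIndex_eq_of_le {j k : ℤ} (hjk : j ≤ k) {u v : ℝ}
    (h : dyadicIndex j u = dyadicIndex j v) : dyadicIndex k u = dyadicIndex k v := by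
  obtain ⟨m, rfl⟩ := Int.exists_add_of_le hjk
  have key : ∀ w : ℝ, dyadicIndex (j + m) w = dyadicIndex j w / ((2 ^ m : ℕ) : ℤ) := by
    intro w
    rw [dyadicIndex, dyadicIndex, ← Int.floor_div_natCast, div_div, zpow_add₀ two_ne_zero]
    push_cast
    rfl
  rw [key, key, h]

/-- The normalized Lebesgue measure on a dyadic interval. -/
def dyadicMeasure (k n : ℤ) : Measure ℝ :=
  (ENNReal.ofReal ((2 : ℝ) ^ k))⁻¹ • volume.restrict (dyadicIco k n)

lemma ofReal_two_zpow_ne_zero (k : ℤ) : ENNReal.ofReal ((2 : ℝ) ^ k) ≠ 0 := by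
  have : (0 : ℝ) < 2 ^ k := by positivity
  simpa using this

instance (k n : ℤ) : IsProbabilityMeasure (dyadicMeasure k n) := by
  constructor
  rw [dyadicMeasure, Measure.smul_apply, Measure.restrict_apply_univ, volume_dyadicIco,
    smul_eq_mul, ENNReal.inv_mul_cancel (ofReal_two_zpow_ne_zero k) ENNReal.ofReal_ne_top]

lemma ae_mem_dyadicIco (k n : ℤ) : ∀ᵐ u ∂(dyadicMeasure k n), u ∈ dyadicIco k n :=
  Measure.ae_smul_measure (ae_restrict_mem (measurableSet_dyadicIco k n)) _

/-- The average of `f` over the dyadic interval of length `2^k` containing `u`. -/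
def dyadicAverage (f : ℝ → ℝ≥0∞) (k : ℤ) (u : ℝ) : ℝ≥0∞ :=
  ∫⁻ y, f y ∂(dyadicMeasure k (dyadicIndex k u))

/-- The dyadic maximal function on the line. -/
def dyadicMaximal (f : ℝ → ℝ≥0∞) (u : ℝ) : ℝ≥0∞ := ⨆ k, dyadicAverage f k u

lemma measurable_dyadicAverage (f : ℝ → ℝ≥0∞) (k : ℤ) : Measurable (dyadicAverage f k) :=
  (measurable_from_top (f := fun n : ℤ => ∫⁻ y, f y ∂(dyadicMeasure k n))).comp
    (measurable_dyadicIndex k)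

lemma measurable_dyadicMaximal (f : ℝ → ℝ≥0∞) : Measurable (dyadicMaximal f) :=
  Measurable.iSup fun k => measurable_dyadicAverage f k

lemma mul_measure_le_of_lt_dyadicAverage {f : ℝ → ℝ≥0∞} {k : ℤ} {c : ℝ≥0∞} {A : Set ℝ}
    (hA : MeasurableSet A) (hlt : ∀ u ∈ A, c < dyadicAverage f k u)
    (hinv : ∀ u v, dyadicIndex k u = dyadicIndex k v → u ∈ A → v ∈ A) :
    c * volume A ≤ ∫⁻ u in A, f u := by
  have hcover : A = ⋃ n, A ∩ dyadicIco k n := by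
    rw [← Set.inter_iUnion, iUnion_dyadicIco, Set.inter_univ]
  have hmeas : ∀ n, MeasurableSet (A ∩ dyadicIco k n) := fun n =>
    hA.inter (measurableSet_dyadicIco k n)
  have hdisj : Pairwise (Function.onFun Disjoint fun n => A ∩ dyadicIco k n) := fun m n hmn =>
    (pairwise_disjoint_dyadicIco k hmn).mono Set.inter_subset_right Set.inter_subset_right
  rw [hcover, measure_iUnion hdisj hmeas, lintegral_iUnion hmeas hdisj, ← ENNReal.tsum_mul_left]
  refine ENNReal.tsum_le_tsum fun n => ?_
  rcases (A ∩ dyadicIco k n).eq_empty_or_nonempty with h | ⟨u, huA, hun⟩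
  · simp [h]
  · rw [mem_dyadicIco] at hun
    have hsub : dyadicIco k n ⊆ A := fun v hv =>
      hinv u v (by rw [hun, mem_dyadicIco.1 hv]) huA
    rw [Set.inter_eq_right.2 hsub, volume_dyadicIco]
    have h := (hlt u huA).le
    rw [dyadicAverage, hun, dyadicMeasure, lintegral_smul_measure, smul_eq_mul, mul_comm,
      ← div_eq_mul_inv] at h
    exact (ENNReal.le_div_iff_mul_le (Or.inl (ofReal_two_zpow_ne_zero k))
      (Or.inl ENNReal.ofReal_ne_top)).1 h

/-- The weak type (1,1) bound for averages over dyadic intervals of bounded length. -/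
lemma mul_volume_iUnion_lt_dyadicAverage_le (f : ℝ → ℝ≥0∞) (c : ℝ≥0∞) (K : ℤ) :
    c * volume (⋃ n : ℕ, {u | c < dyadicAverage f (K - n) u}) ≤ ∫⁻ u, f u := by
  set D : ℕ → Set ℝ := fun n => {u | c < dyadicAverage f (K - n) u} with hD
  have hmeas : ∀ n, MeasurableSet (disjointed D n) := MeasurableSet.disjointed fun n =>
    measurableSet_lt measurable_const (measurable_dyadicAverage f _)
  have hinvD : ∀ m n : ℕ, m ≤ n → ∀ u v, dyadicIndex (K - n) u = dyadicIndex (K - n) v →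
      u ∈ D m → v ∈ D m := by
    intro m n hmn u v huv hu
    have : dyadicIndex (K - m) u = dyadicIndex (K - m) v := dyadicIndex_eq_of_le (by omega) huv
    simp only [hD, Set.mem_ofPred_eq, dyadicAverage] at hu ⊢
    rwa [← this]
  rw [← iUnion_disjointed, measure_iUnion (disjoint_disjointed D) hmeas, ← ENNReal.tsum_mul_left]
  calc ∑' n, c * volume (disjointed D n) ≤ ∑' n, ∫⁻ u in disjointed D n, f u := by
        refine ENNReal.tsum_le_tsum fun n => mul_measure_le_of_lt_dyadicAverage (k := K - n)
          (hmeas n) (fun u hu => disjointed_subset D n hu) fun u v huv hu => ?_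
        rw [disjointed_eq_inter_compl] at hu ⊢
        simp only [Set.mem_inter_iff, Set.mem_iInter, Set.mem_compl_iff] at hu ⊢
        exact ⟨hinvD n n le_rfl u v huv hu.1, fun m hm hv =>
          hu.2 m hm (hinvD m n hm.le v u huv.symm hv)⟩
    _ = ∫⁻ u in ⋃ n, disjointed D n, f u := (lintegral_iUnion hmeas (disjoint_disjointed D) f).symm
    _ ≤ ∫⁻ u, f u := setLIntegral_le_lintegral _ _

/-- The weak type (1,1) bound for the dyadic maximal function. -/
lemma mul_volume_lt_dyadicMaximal_le (f : ℝ → ℝ≥0∞) (c : ℝ≥0∞) :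
    c * volume {u | c < dyadicMaximal f u} ≤ ∫⁻ u, f u := by
  have hset : {u | c < dyadicMaximal f u} =
      ⋃ K : ℕ, ⋃ n : ℕ, {u | c < dyadicAverage f (K - n) u} := by
    ext u
    simp only [dyadicMaximal, Set.mem_ofPred_eq, lt_iSup_iff, Set.mem_iUnion]
    constructor
    · rintro ⟨k, hk⟩
      refine ⟨k.toNat, (-k).toNat, ?_⟩
      have : (k.toNat : ℤ) - ((-k).toNat : ℤ) = k := by omega
      rwa [this]
    · rintro ⟨K, n, h⟩
      exact ⟨_, h⟩
  have hmono : Monotone fun K : ℕ => ⋃ n : ℕ, {u | c < dyadicAverage f (K - n) u} := by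
    intro K L hKL
    refine Set.iUnion_subset fun n => ?_
    refine Set.Subset.trans ?_ (Set.subset_iUnion _ (n + (L - K)))
    have : (L : ℤ) - ((n + (L - K) : ℕ) : ℤ) = K - n := by omega
    rw [this]
  rw [hset, hmono.measure_iUnion, ENNReal.mul_iSup]
  exact iSup_le fun K => mul_volume_iUnion_lt_dyadicAverage_le f c K

lemma lintegral_rpow_le_of_isProbabilityMeasure {α : Type*} [MeasurableSpace α] {μ : Measure α}
    [IsProbabilityMeasure μ] {f : α → ℝ≥0∞} (hf : Measurable f) {p : ℝ} (hp : 1 ≤ p) :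
    (∫⁻ x, f x ∂μ) ^ p ≤ ∫⁻ x, f x ^ p ∂μ := by
  have hp0 : 0 < p := by linarith
  have h := eLpNorm'_le_eLpNorm'_of_exponent_le one_pos hp μ hf.aestronglyMeasurable
  simp only [eLpNorm', enorm_eq_self, ENNReal.rpow_one, div_one] at h
  calc (∫⁻ x, f x ∂μ) ^ p ≤ ((∫⁻ x, f x ^ p ∂μ) ^ (1 / p)) ^ p :=
        ENNReal.rpow_le_rpow h hp0.le
    _ = ∫⁻ x, f x ^ p ∂μ := by
        rw [← ENNReal.rpow_mul, one_div_mul_cancel hp0.ne', ENNReal.rpow_one]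

/-- The weak type (p,p) bound for the dyadic maximal function. -/
lemma rpow_mul_volume_lt_dyadicMaximal_le {f : ℝ → ℝ≥0∞} (hf : Measurable f) {p : ℝ}
    (hp : 1 ≤ p) (c : ℝ≥0∞) :
    c ^ p * volume {u | c < dyadicMaximal f u} ≤ ∫⁻ u, f u ^ p := by
  refine le_trans ?_ (mul_volume_lt_dyadicMaximal_le (fun u => f u ^ p) (c ^ p))
  refine mul_le_mul_right (measure_mono fun u hc => ?_) _
  obtain ⟨k, hk⟩ := lt_iSup_iff.1 (show c < ⨆ k, dyadicAverage f k u from hc)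
  exact lt_iSup_iff.2 ⟨k, (ENNReal.rpow_lt_rpow hk (by linarith)).trans_le
    (lintegral_rpow_le_of_isProbabilityMeasure hf hp)⟩

lemma dyadicMaximal_le_one {f : ℝ → ℝ≥0∞} (hf : ∀ u, f u ≤ 1) (u : ℝ) :
    dyadicMaximal f u ≤ 1 := by
  refine iSup_le fun k => ?_
  calc dyadicAverage f k u ≤ ∫⁻ _, 1 ∂(dyadicMeasure k (dyadicIndex k u)) := lintegral_mono hf
    _ = 1 := by simp

/-- Layer decomposition at the levels `2^{-m}`. -/
lemma rpow_le_tsum_indicator {x : ℝ≥0∞} (hx : x ≤ 1) {q : ℝ} (hq : 0 < q) :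
    x ^ q ≤ ∑' m : ℕ, if (2⁻¹ : ℝ≥0∞) ^ (m + 1) < x then ((2⁻¹ : ℝ≥0∞) ^ m) ^ q else 0 := by
  rcases eq_or_ne x 0 with rfl | hx0
  · simp [hq]
  · have hxt : x ≠ ⊤ := ne_top_of_le_ne_top ENNReal.one_ne_top hx
    obtain ⟨m, hm1, hm2⟩ := exists_nat_pow_near_of_lt_one (x := x.toReal) (y := (2⁻¹ : ℝ))
      (ENNReal.toReal_pos hx0 hxt) (ENNReal.toReal_le_of_le_ofReal zero_le_one (by simpa using hx))
      (by norm_num) (by norm_num)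
    have hpow : ∀ n : ℕ, ((2⁻¹ : ℝ≥0∞) ^ n).toReal = (2⁻¹ : ℝ) ^ n := fun n => by simp
    have hne : ∀ n : ℕ, (2⁻¹ : ℝ≥0∞) ^ n ≠ ⊤ := fun n => ENNReal.pow_ne_top (by simp)
    rw [← hpow, ENNReal.toReal_lt_toReal (hne _) hxt] at hm1
    rw [← hpow, ENNReal.toReal_le_toReal hxt (hne _)] at hm2
    refine le_trans ?_ (ENNReal.le_tsum m)
    rw [if_pos hm1]
    exact ENNReal.rpow_le_rpow hm2 hq.le

/-- The dyadic maximal function maps `L^p` to `L^q` for `q > p` on functions bounded by `1`. -/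
lemma lintegral_dyadicMaximal_rpow_le {p q : ℝ} (hp : 1 ≤ p) (hpq : p < q) :
    ∃ C : ℝ≥0∞, C ≠ ⊤ ∧ ∀ f : ℝ → ℝ≥0∞, Measurable f → (∀ u, f u ≤ 1) →
      ∫⁻ u, dyadicMaximal f u ^ q ≤ C * ∫⁻ u, f u ^ p := by
  have hp0 : 0 < p := by linarith
  set r : ℝ≥0∞ := (2⁻¹ : ℝ≥0∞) ^ (q - p) with hr
  have hr1 : r < 1 := ENNReal.rpow_lt_one (by simp) (by linarith)
  refine ⟨((2⁻¹ : ℝ≥0∞) ^ p)⁻¹ * (1 - r)⁻¹, ENNReal.mul_ne_top ?_ ?_, fun f hf hf1 => ?_⟩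
  · simp [ENNReal.rpow_eq_zero_iff]
  · simpa [tsub_eq_zero_iff_le] using hr1
  have hterm : ∀ m : ℕ, ((2⁻¹ : ℝ≥0∞) ^ m) ^ q =
      ((2⁻¹ : ℝ≥0∞) ^ p)⁻¹ * r ^ m * ((2⁻¹ : ℝ≥0∞) ^ (m + 1)) ^ p := by
    intro m
    have h0 : (2⁻¹ : ℝ≥0∞) ≠ 0 := by simp
    have ht : (2⁻¹ : ℝ≥0∞) ≠ ⊤ := by simp
    rw [hr, ← ENNReal.rpow_natCast, ← ENNReal.rpow_natCast, ← ENNReal.rpow_natCast,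
      ← ENNReal.rpow_mul, ← ENNReal.rpow_mul, ← ENNReal.rpow_mul, ← ENNReal.rpow_neg,
      ← ENNReal.rpow_add _ _ h0 ht, ← ENNReal.rpow_add _ _ h0 ht]
    congr 1
    push_cast
    ring
  have hset : ∀ m : ℕ, MeasurableSet {u | (2⁻¹ : ℝ≥0∞) ^ (m + 1) < dyadicMaximal f u} :=
    fun m => measurableSet_lt measurable_const (measurable_dyadicMaximal f)
  calc ∫⁻ u, dyadicMaximal f u ^ q
      ≤ ∫⁻ u, ∑' m : ℕ, Set.indicator {u | (2⁻¹ : ℝ≥0∞) ^ (m + 1) < dyadicMaximal f u}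
          (fun _ => ((2⁻¹ : ℝ≥0∞) ^ m) ^ q) u := by
        refine lintegral_mono fun u => ?_
        simpa [Set.indicator_apply] using
          rpow_le_tsum_indicator (dyadicMaximal_le_one hf1 u) (by linarith : 0 < q)
    _ = ∑' m : ℕ, ((2⁻¹ : ℝ≥0∞) ^ m) ^ q *
          volume {u | (2⁻¹ : ℝ≥0∞) ^ (m + 1) < dyadicMaximal f u} := by
        rw [lintegral_tsum fun m => (measurable_const.indicator (hset m)).aemeasurable]
        exact tsum_congr fun m => lintegral_indicator_const (hset m) _
    _ ≤ ∑' m : ℕ, ((2⁻¹ : ℝ≥0∞) ^ p)⁻¹ * r ^ m * ∫⁻ u, f u ^ p := by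
        refine ENNReal.tsum_le_tsum fun m => ?_
        rw [hterm, mul_assoc]
        gcongr
        exact rpow_mul_volume_lt_dyadicMaximal_le hf hp _
    _ = ((2⁻¹ : ℝ≥0∞) ^ p)⁻¹ * (1 - r)⁻¹ * ∫⁻ u, f u ^ p := by
        rw [ENNReal.tsum_mul_right, ENNReal.tsum_mul_left, ENNReal.tsum_geometric]

end DyadicMaximal

section StrongMaximal

variable {ι : Type*} [DecidableEq ι]

/-- The dyadic maximal function in the `i`-th coordinate. -/
def coordMaximal (i : ι) (F : (ι → ℝ) → ℝ≥0∞) (x : ι → ℝ) : ℝ≥0∞ :=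
  dyadicMaximal (fun u => F (Function.update x i u)) (x i)

/-- The composition of the coordinate maximal functions along a list of coordinates. -/
def iteratedMaximal (F : (ι → ℝ) → ℝ≥0∞) : List ι → (ι → ℝ) → ℝ≥0∞
  | [] => F
  | i :: l => coordMaximal i (iteratedMaximal F l)

lemma measurable_coordMaximal (i : ι) {F : (ι → ℝ) → ℝ≥0∞} (hF : Measurable F) :
    Measurable (coordMaximal i F) := by
  unfold coordMaximal dyadicMaximal dyadicAverage
  refine Measurable.iSup fun k => ?_
  have hn : ∀ n : ℤ, Measurable fun x : ι → ℝ =>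
      ∫⁻ y, F (Function.update x i y) ∂(dyadicMeasure k n) := fun n =>
    Measurable.lintegral_prod_right' (ν := dyadicMeasure k n)
      (f := fun w : (ι → ℝ) × ℝ => F (Function.update w.1 i w.2)) (hF.comp measurable_update')
  have h : Measurable (Function.uncurry fun (n : ℤ) (x : ι → ℝ) =>
      ∫⁻ y, F (Function.update x i y) ∂(dyadicMeasure k n)) :=
    measurable_from_prod_countable_right hn
  have hi : Measurable fun x : ι → ℝ => (dyadicIndex k (x i), x) :=
    ((measurable_dyadicIndex k).comp (measurable_pi_apply i)).prodMk measurable_id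
  simpa only [Function.comp_def, Function.uncurry] using h.comp hi

lemma measurable_iteratedMaximal {F : (ι → ℝ) → ℝ≥0∞} (hF : Measurable F) (l : List ι) :
    Measurable (iteratedMaximal F l) := by
  induction l with
  | nil => exact hF
  | cons i l ih => exact measurable_coordMaximal i ih

lemma iteratedMaximal_le_one {F : (ι → ℝ) → ℝ≥0∞} (hF : ∀ x, F x ≤ 1) (l : List ι) (x : ι → ℝ) :
    iteratedMaximal F l x ≤ 1 := by
  induction l generalizing x with
  | nil => exact hF x
  | cons i l ih => exact dyadicMaximal_le_one (fun u => ih _) _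

lemma lintegral_coordMaximal_rpow_le [Fintype ι] (i : ι) {p q : ℝ} {C : ℝ≥0∞}
    (hC : ∀ f : ℝ → ℝ≥0∞, Measurable f → (∀ u, f u ≤ 1) →
      ∫⁻ u, dyadicMaximal f u ^ q ≤ C * ∫⁻ u, f u ^ p)
    {F : (ι → ℝ) → ℝ≥0∞} (hF : Measurable F) (hF1 : ∀ x, F x ≤ 1) :
    ∫⁻ x, coordMaximal i F x ^ q ≤ C * ∫⁻ x, F x ^ p := by
  rw [← lintegral_const_mul _ (hF.pow_const p)]
  refine lintegral_le_of_lmarginal_le (μ := fun _ : ι => (volume : Measure ℝ)) {i}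
    ((measurable_coordMaximal i hF).pow_const q) ((hF.pow_const p).const_mul C) fun x => ?_
  rw [lmarginal_singleton, lmarginal_singleton]
  have hFx : Measurable fun u => F (Function.update x i u) := hF.comp (measurable_update x)
  beta_reduce
  rw [lintegral_const_mul _ (hFx.pow_const p)]
  simpa [coordMaximal] using hC _ hFx fun u => hF1 _

lemma lintegral_iteratedMaximal_rpow_le [Fintype ι] {ε : ℝ} (hε : 0 < ε) (l : List ι) :
    ∃ C : ℝ≥0∞, C ≠ ⊤ ∧ ∀ F : (ι → ℝ) → ℝ≥0∞, Measurable F → (∀ x, F x ≤ 1) →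
      ∫⁻ x, iteratedMaximal F l x ^ (1 + l.length * ε) ≤ C * ∫⁻ x, F x := by
  induction l with
  | nil => exact ⟨1, by simp, fun F _ _ => by simp [iteratedMaximal]⟩
  | cons i l ih =>
    obtain ⟨C, hC, hCF⟩ := ih
    have h1 : 1 ≤ 1 + l.length * ε := by
      have : 0 ≤ l.length * ε := by positivity
      linarith
    have h2 : 1 + l.length * ε < 1 + (i :: l).length * ε := by
      rw [List.length_cons]
      push_cast
      linarith
    obtain ⟨B, hB, hBF⟩ := lintegral_dyadicMaximal_rpow_le h1 h2
    refine ⟨B * C, ENNReal.mul_ne_top hB hC, fun F hF hF1 => ?_⟩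
    calc ∫⁻ x, iteratedMaximal F (i :: l) x ^ (1 + (i :: l).length * ε)
        ≤ B * ∫⁻ x, iteratedMaximal F l x ^ (1 + l.length * ε) :=
          lintegral_coordMaximal_rpow_le i hBF (measurable_iteratedMaximal hF l)
            (iteratedMaximal_le_one hF1 l)
      _ ≤ B * (C * ∫⁻ x, F x) := by gcongr; exact hCF F hF hF1
      _ = B * C * ∫⁻ x, F x := (mul_assoc _ _ _).symm

/-- Averages over products of dyadic intervals are dominated by the iterated maximal function. -/
lemma lmarginal_dyadicMeasure_le_iteratedMaximal {F : (ι → ℝ) → ℝ≥0∞} (hF : Measurable F)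
    (k n : ι → ℤ) (l : List ι) (hl : l.Nodup) (x : ι → ℝ)
    (hx : ∀ i ∈ l, x i ∈ dyadicIco (k i) (n i)) :
    (∫⋯∫⁻_l.toFinset, F ∂(fun i => dyadicMeasure (k i) (n i))) x ≤ iteratedMaximal F l x := by
  induction l generalizing x with
  | nil => simp [iteratedMaximal]
  | cons i l ih =>
    obtain ⟨hil, hl⟩ := List.nodup_cons.1 hl
    rw [List.toFinset_cons, lmarginal_insert F hF (by simpa using hil)]
    have hxi : dyadicIndex (k i) (x i) = n i := mem_dyadicIco.1 (hx i (by simp))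
    refine le_trans ?_ (le_iSup _ (k i))
    rw [dyadicAverage, hxi]
    refine lintegral_mono_ae ?_
    filter_upwards [ae_mem_dyadicIco (k i) (n i)] with u hu
    refine ih hl _ fun j hj => ?_
    have hji : j ≠ i := fun h => hil (h ▸ hj)
    rw [Function.update_of_ne hji]
    exact hx j (by simp [hj])

end StrongMaximal

section DyadicBox

variable {ι : Type*}

/-- A product of dyadic intervals. -/
def dyadicBox (k n : ι → ℤ) : Set (ι → ℝ) := Set.univ.pi fun i => dyadicIco (k i) (n i)

lemma volume_dyadicBox [Fintype ι] (k n : ι → ℤ) :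
    volume (dyadicBox k n) = ∏ i, ENNReal.ofReal ((2 : ℝ) ^ k i) := by
  rw [dyadicBox, volume_pi_pi]
  simp_rw [volume_dyadicIco]

lemma pi_dyadicMeasure_dyadicBox [Fintype ι] (k n k' n' : ι → ℤ) (h : dyadicBox k' n' ⊆ dyadicBox k n)
    {ρ : ℝ≥0∞} (hρ : volume (dyadicBox k' n') = ρ * volume (dyadicBox k n)) :
    Measure.pi (fun i => dyadicMeasure (k i) (n i)) (dyadicBox k' n') = ρ := by
  have hterm : ∀ i, dyadicMeasure (k i) (n i) (dyadicIco (k' i) (n' i)) =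
      (ENNReal.ofReal ((2 : ℝ) ^ k i))⁻¹ *
        volume (dyadicIco (k' i) (n' i) ∩ dyadicIco (k i) (n i)) := by
    intro i
    rw [dyadicMeasure, Measure.smul_apply, Measure.restrict_apply (measurableSet_dyadicIco _ _),
      smul_eq_mul]
  have hinter : ∏ i, volume (dyadicIco (k' i) (n' i) ∩ dyadicIco (k i) (n i)) =
      volume (dyadicBox k' n') := by
    rw [← volume_pi_pi, Set.pi_inter_distrib]
    exact congrArg volume (Set.inter_eq_left.2 h)
  have hne : ∏ i, ENNReal.ofReal ((2 : ℝ) ^ k i) ≠ 0 :=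
    Finset.prod_ne_zero_iff.2 fun i _ => ofReal_two_zpow_ne_zero _
  have htop : ∏ i, ENNReal.ofReal ((2 : ℝ) ^ k i) ≠ ⊤ :=
    ENNReal.prod_ne_top fun i _ => ENNReal.ofReal_ne_top
  rw [dyadicBox, Measure.pi_pi]
  simp_rw [hterm]
  rw [Finset.prod_mul_distrib, hinter, hρ, volume_dyadicBox,
    ← ENNReal.prod_inv_distrib fun i _ _ _ _ => Or.inr ENNReal.ofReal_ne_top, mul_comm, mul_assoc,
    ENNReal.mul_inv_cancel hne htop, mul_one]

/-- The union of the dyadic boxes containing a subbox of proportion `ρ` inside `U` has measure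
at most a constant times `ρ^{-1-ε} |U|`. -/
lemma exists_rpow_mul_volume_le (ι : Type*) [Fintype ι] {ε : ℝ} (hε : 0 < ε) :
    ∃ C : ℝ≥0∞, C ≠ ⊤ ∧ ∀ U : Set (ι → ℝ), MeasurableSet U → ∀ ρ : ℝ≥0∞, ρ ≤ 1 →
      ∃ G : Set (ι → ℝ), ρ ^ (1 + ε) * volume G ≤ C * volume U ∧
        ∀ k n k' n' : ι → ℤ, dyadicBox k' n' ⊆ dyadicBox k n →
          volume (dyadicBox k' n') = ρ * volume (dyadicBox k n) →
          dyadicBox k' n' ⊆ U → dyadicBox k n ⊆ G := by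
  classical
  set l : List ι := Finset.univ.toList with hl
  obtain ⟨C, hC, hCF⟩ := lintegral_iteratedMaximal_rpow_le
    (div_pos hε (by positivity : (0 : ℝ) < l.length + 1)) l
  refine ⟨C, hC, fun U hU ρ hρ => ?_⟩
  set F : (ι → ℝ) → ℝ≥0∞ := U.indicator 1 with hF_def
  have hF : Measurable F := measurable_one.indicator hU
  have hF1 : ∀ x, F x ≤ 1 := fun x => Set.indicator_le_self' (fun _ _ => zero_le) x
  set q : ℝ := 1 + l.length * (ε / (l.length + 1)) with hq
  have hq0 : 0 < q := by positivity
  have hqε : q ≤ 1 + ε := by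
    have : l.length * (ε / (l.length + 1)) ≤ ε := by
      rw [← mul_div_assoc, div_le_iff₀ (by positivity)]
      nlinarith
    linarith
  refine ⟨{x | ρ ≤ iteratedMaximal F l x}, ?_, fun k n k' n' hsub hvol hkU x hx => ?_⟩
  · calc ρ ^ (1 + ε) * volume {x | ρ ≤ iteratedMaximal F l x}
        ≤ ρ ^ q * volume {x | ρ ^ q ≤ iteratedMaximal F l x ^ q} := by
          gcongr ?_ * volume ?_
          · exact ENNReal.rpow_le_rpow_of_exponent_ge hρ hqε
          · exact fun x hx => ENNReal.rpow_le_rpow hx hq0.le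
      _ ≤ ∫⁻ x, iteratedMaximal F l x ^ q :=
          mul_meas_ge_le_lintegral ((measurable_iteratedMaximal hF l).pow_const q) _
      _ ≤ C * ∫⁻ x, F x := hCF F hF hF1
      _ = C * volume U := by rw [hF_def, lintegral_indicator_one hU]
  · have hx' : ∀ i ∈ l, x i ∈ dyadicIco (k i) (n i) := fun i _ => hx i (Set.mem_univ i)
    have h := lmarginal_dyadicMeasure_le_iteratedMaximal hF k n l (Finset.nodup_toList _) x hx'
    rw [hl, Finset.toList_toFinset, lmarginal_univ, hF_def, lintegral_indicator_one hU] at h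
    calc ρ = Measure.pi (fun i => dyadicMeasure (k i) (n i)) (dyadicBox k' n') :=
          (pi_dyadicMeasure_dyadicBox k n k' n' hsub hvol).symm
      _ ≤ Measure.pi (fun i => dyadicMeasure (k i) (n i)) U := measure_mono hkU
      _ ≤ _ := h

end DyadicBox

section Rectangles

lemma DyadicRect.toSet_eq_preimage (R : DyadicRect t d) :
    R.toSet = (WithLp.ofLp : Rd t d → _) ⁻¹'
      dyadicBox (fun i => R.k i.1) (fun i => R.pos i.1 i.2) := by
  ext x
  simp [DyadicRect.toSet, dyadicBox, dyadicIco, Sigma.forall]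

/-- The set of dyadic rectangles with a dyadic subrectangle of proportion `ρ` inside `U` is
covered by a set of measure at most a constant times `ρ^{-1-ε} |U|`. -/
lemma exists_rpow_mul_volume_toSet_le (t : ℕ) (d : Fin t → ℕ) {ε : ℝ} (hε : 0 < ε) :
    ∃ C : ℝ≥0∞, C ≠ ⊤ ∧ ∀ U : Set (Rd t d), MeasurableSet U → ∀ ρ : ℝ≥0∞, ρ ≤ 1 →
      ∃ G : Set (Rd t d), ρ ^ (1 + ε) * volume G ≤ C * volume U ∧
        ∀ R R' : DyadicRect t d, R'.toSet ⊆ R.toSet → volume R'.toSet = ρ * volume R.toSet →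
          R'.toSet ⊆ U → R.toSet ⊆ G := by
  obtain ⟨C, hC, h⟩ := exists_rpow_mul_volume_le ((s : Fin t) × Fin (d s)) hε
  refine ⟨C, hC, fun U hU ρ hρ => ?_⟩
  let e : Rd t d ≃ᵐ ((s : Fin t) × Fin (d s) → ℝ) := (MeasurableEquiv.toLp 2 _).symm
  have he : MeasurePreserving e := EuclideanSpace.volume_preserving_symm_measurableEquiv_toLp _
  have hset : ∀ R : DyadicRect t d, R.toSet =
      e ⁻¹' dyadicBox (fun i => R.k i.1) (fun i => R.pos i.1 i.2) := fun R => R.toSet_eq_preimage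
  have hsub : ∀ A B, e ⁻¹' A ⊆ e ⁻¹' B ↔ A ⊆ B := fun A B => e.surjective.preimage_subset_preimage_iff
  have hUe : e ⁻¹' (e.symm ⁻¹' U) = U := by
    rw [← Set.preimage_comp, e.symm_comp_self, Set.preimage_id]
  obtain ⟨G, hG, hGR⟩ := h (e.symm ⁻¹' U) (e.symm.measurable hU) ρ hρ
  refine ⟨e ⁻¹' G, ?_, fun R R' h1 h2 h3 => ?_⟩
  · rwa [← he.measure_preimage_equiv, ← he.measure_preimage_equiv, hUe] at hG
  · rw [hset, hset, hsub] at h1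
    rw [hset, hset, he.measure_preimage_equiv, he.measure_preimage_equiv] at h2
    rw [hset, ← hUe, hsub] at h3
    rw [hset, hsub]
    exact hGR _ _ _ _ h1 h2 h3

lemma tsum_subset_le_carlesonNorm (a : DyadicRect t d → ℂ) {U : Set (Rd t d)} (hU : IsOpen U)
    (hU0 : 0 < volume U) (hUt : volume U < ⊤) :
    ∑' R : {R : DyadicRect t d // R.toSet ⊆ U}, ((‖a R.1‖₊ : ℝ≥0∞)) ^ 2 ≤
      volume U * carlesonNorm a ^ (2 : ℝ) := by
  set T := ∑' R : {R : DyadicRect t d // R.toSet ⊆ U}, ((‖a R.1‖₊ : ℝ≥0∞)) ^ 2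
  have h : ((volume U)⁻¹ * T) ^ (1 / 2 : ℝ) ≤ carlesonNorm a :=
    le_iSup₂_of_le (f := fun (U : Set (Rd t d)) (_ : IsOpen U ∧ 0 < volume U ∧ volume U < ⊤) =>
      ((volume U)⁻¹ * ∑' R : {R : DyadicRect t d // R.toSet ⊆ U}, ((‖a R.1‖₊ : ℝ≥0∞)) ^ 2) ^
        (1 / 2 : ℝ)) U ⟨hU, hU0, hUt⟩ le_rfl
  have h2 := ENNReal.rpow_le_rpow h (by norm_num : (0 : ℝ) ≤ 2)
  rw [← ENNReal.rpow_mul, one_div_mul_cancel two_ne_zero, ENNReal.rpow_one, mul_comm,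
    ← div_eq_mul_inv, ENNReal.div_le_iff hU0.ne' hUt.ne] at h2
  rwa [mul_comm]

/-- The sum of the squared coefficients of a scale shift over the rectangles in `U` is at most
`ρ` times the corresponding sum over a set `W` containing all rectangles `R` with `σ R ⊆ U`. -/
lemma tsum_scaleShift_le {ρ : ℝ} (hρ : 0 ≤ ρ) {σ : DyadicRect t d → DyadicRect t d}
    (hσ : Function.Injective σ) {a Sa : DyadicRect t d → ℂ}
    (h1 : ∀ R, Sa (σ R) = (Real.sqrt ρ : ℂ) * a R) (h2 : ∀ R', R' ∉ Set.range σ → Sa R' = 0)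
    {U W : Set (Rd t d)} (hUW : ∀ R, (σ R).toSet ⊆ U → R.toSet ⊆ W) :
    ∑' R : {R : DyadicRect t d // R.toSet ⊆ U}, ((‖Sa R.1‖₊ : ℝ≥0∞)) ^ 2 ≤
      ENNReal.ofReal ρ *
        ∑' R : {R : DyadicRect t d // R.toSet ⊆ W}, ((‖a R.1‖₊ : ℝ≥0∞)) ^ 2 := by
  have hsub : ∀ (b : DyadicRect t d → ℂ) (V : Set (Rd t d)),
      ∑' R : {R : DyadicRect t d // R.toSet ⊆ V}, ((‖b R.1‖₊ : ℝ≥0∞)) ^ 2 =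
        ∑' R, Set.indicator {R : DyadicRect t d | R.toSet ⊆ V}
          (fun R => ((‖b R‖₊ : ℝ≥0∞)) ^ 2) R := fun b V =>
    tsum_subtype {R : DyadicRect t d | R.toSet ⊆ V} fun R => ((‖b R‖₊ : ℝ≥0∞)) ^ 2
  have hsq : ∀ R, ((‖Sa (σ R)‖₊ : ℝ≥0∞)) ^ 2 = ENNReal.ofReal ρ * ((‖a R‖₊ : ℝ≥0∞)) ^ 2 := by
    intro R
    have : ((‖(Real.sqrt ρ : ℂ)‖₊ : ℝ≥0∞)) = ENNReal.ofReal (Real.sqrt ρ) := by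
      rw [← enorm_eq_nnnorm, ← ofReal_norm, Complex.norm_real,
        Real.norm_of_nonneg (Real.sqrt_nonneg ρ)]
    rw [h1, nnnorm_mul, ENNReal.coe_mul, mul_pow, this,
      ← ENNReal.ofReal_pow (Real.sqrt_nonneg ρ), Real.sq_sqrt hρ]
  rw [hsub, hsub, ← ENNReal.tsum_mul_left, ← hσ.tsum_eq]
  · refine ENNReal.tsum_le_tsum fun R => ?_
    by_cases hR : (σ R).toSet ⊆ U
    · rw [Set.indicator_of_mem (show σ R ∈ {R : DyadicRect t d | R.toSet ⊆ U} from hR),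
        Set.indicator_of_mem (show R ∈ {R : DyadicRect t d | R.toSet ⊆ W} from hUW R hR), hsq]
    · rw [Set.indicator_of_notMem (show σ R ∉ {R : DyadicRect t d | R.toSet ⊆ U} from hR)]
      exact zero_le
  · intro R' hR'
    by_contra hn
    exact hR' (by simp [h2 R' hn])

end Rectangles

/-- **Scale shifts on product BMO** (coefficient form of Theorem 4.5): a scale shift of
parameter `ρ` maps product BMO to itself with norm `≲ ρ^{−κ}` for every `κ > 0`. -/
theorem scale_shift_carleson_bound (t : ℕ) (ht : 0 < t) (d : Fin t → ℕ)
    (hd : ∀ s, 0 < d s) (κ : ℝ) (hκ : 0 < κ) :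
    ∃ C : ℝ, 0 < C ∧
      ∀ ρ : ℝ, 0 < ρ → ρ ≤ 1 →
      ∀ σ : DyadicRect t d → DyadicRect t d, Function.Injective σ →
        (∀ R, (σ R).toSet ⊆ R.toSet) →
        (∀ R, volume (σ R).toSet = ENNReal.ofReal ρ * volume R.toSet) →
      ∀ a Sa : DyadicRect t d → ℂ,
        (∀ R, Sa (σ R) = (Real.sqrt ρ : ℂ) * a R) →
        (∀ R' : DyadicRect t d, R' ∉ Set.range σ → Sa R' = 0) →
        carlesonNorm Sa ≤ ENNReal.ofReal (C * ρ ^ (-κ)) * carlesonNorm a := by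
  obtain ⟨C, hC, hG⟩ := exists_rpow_mul_volume_toSet_le t d (by positivity : 0 < 2 * κ)
  refine ⟨Real.sqrt (C.toReal + 2), by positivity, fun ρ hρ hρ1 σ hσ hsub hvol a Sa h1 h2 => ?_⟩
  have hρ0 : ENNReal.ofReal ρ ≠ 0 := by simpa using hρ
  have hρt : ENNReal.ofReal ρ ≠ ⊤ := ENNReal.ofReal_ne_top
  have hρ1' : ENNReal.ofReal ρ ≤ 1 := by simpa using hρ1
  have hconst : (C + 2) * ENNReal.ofReal ρ ^ (-(2 * κ)) =
      ENNReal.ofReal (Real.sqrt (C.toReal + 2) * ρ ^ (-κ)) ^ (2 : ℝ) := by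
    rw [ENNReal.ofReal_mul (Real.sqrt_nonneg _), ENNReal.mul_rpow_of_nonneg _ _ zero_le_two,
      ← ENNReal.ofReal_rpow_of_pos hρ, ← ENNReal.rpow_mul, ENNReal.rpow_two,
      ← ENNReal.ofReal_pow (Real.sqrt_nonneg _), Real.sq_sqrt (by positivity),
      ENNReal.ofReal_add ENNReal.toReal_nonneg zero_le_two, ENNReal.ofReal_toReal hC,
      ENNReal.ofReal_ofNat]
    congr 2
    ring
  refine iSup₂_le fun U ⟨hU, hU0, hUt⟩ => ?_
  obtain ⟨G, hGU, hGR⟩ := hG U hU.measurableSet _ hρ1'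
  obtain ⟨V, hGV, hV, hVG⟩ := G.exists_isOpen_le_add volume hU0.ne'
  have hmul : ENNReal.ofReal ρ * volume (V ∪ U) ≤
      (C + 2) * ENNReal.ofReal ρ ^ (-(2 * κ)) * volume U := by
    have hG' : ENNReal.ofReal ρ * volume G ≤ ENNReal.ofReal ρ ^ (-(2 * κ)) * (C * volume U) := by
      calc ENNReal.ofReal ρ * volume G
          = ENNReal.ofReal ρ ^ (-(2 * κ)) * (ENNReal.ofReal ρ ^ (1 + 2 * κ) * volume G) := by
            rw [← mul_assoc, ← ENNReal.rpow_add _ _ hρ0 hρt]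
            simp
        _ ≤ _ := by gcongr
    have hone : ENNReal.ofReal ρ ≤ ENNReal.ofReal ρ ^ (-(2 * κ)) := by
      refine hρ1'.trans ?_
      exact ENNReal.one_le_rpow_of_pos_of_le_one_of_neg hρ0.bot_lt hρ1' (by linarith)
    calc ENNReal.ofReal ρ * volume (V ∪ U)
        ≤ ENNReal.ofReal ρ * (volume G + volume U + volume U) := by
          gcongr
          exact (measure_union_le V U).trans (by gcongr)
      _ = ENNReal.ofReal ρ * volume G + ENNReal.ofReal ρ * (2 * volume U) := by ring
      _ ≤ ENNReal.ofReal ρ ^ (-(2 * κ)) * (C * volume U) +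
            ENNReal.ofReal ρ ^ (-(2 * κ)) * (2 * volume U) := by gcongr
      _ = _ := by ring
  have hWt : volume (V ∪ U) < ⊤ := by
    have hlt : ENNReal.ofReal ρ * volume (V ∪ U) < ⊤ := by
      refine hmul.trans_lt (ENNReal.mul_lt_top ?_ hUt)
      rw [hconst]
      exact ENNReal.rpow_lt_top_of_nonneg zero_le_two ENNReal.ofReal_ne_top
    exact ENNReal.lt_top_of_mul_ne_top_right hlt.ne hρ0
  have hsum := (tsum_scaleShift_le hρ.le hσ h1 h2 (W := V ∪ U) fun R hR =>
    ((hGR R (σ R) (hsub R) (hvol R) hR).trans hGV).trans Set.subset_union_left).trans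
    (mul_le_mul_right (tsum_subset_le_carlesonNorm a (hV.union hU)
      (hU0.trans_le (measure_mono Set.subset_union_right)) hWt) _)
  have hle : (volume U)⁻¹ *
      ∑' R : {R : DyadicRect t d // R.toSet ⊆ U}, ((‖Sa R.1‖₊ : ℝ≥0∞)) ^ 2 ≤
        (ENNReal.ofReal (Real.sqrt (C.toReal + 2) * ρ ^ (-κ)) * carlesonNorm a) ^ (2 : ℝ) := by
    rw [mul_comm, ← div_eq_mul_inv, ENNReal.div_le_iff hU0.ne' hUt.ne]
    refine hsum.trans ?_
    rw [ENNReal.mul_rpow_of_nonneg _ _ zero_le_two, ← hconst, ← mul_assoc]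
    calc ENNReal.ofReal ρ * volume (V ∪ U) * carlesonNorm a ^ (2 : ℝ)
        ≤ (C + 2) * ENNReal.ofReal ρ ^ (-(2 * κ)) * volume U * carlesonNorm a ^ (2 : ℝ) := by
          gcongr
      _ = _ := by ring
  calc _ ≤ ((ENNReal.ofReal (Real.sqrt (C.toReal + 2) * ρ ^ (-κ)) * carlesonNorm a) ^ (2 : ℝ)) ^
        (1 / 2 : ℝ) := ENNReal.rpow_le_rpow hle (by norm_num)
    _ = _ := by rw [← ENNReal.rpow_mul]; norm_num
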